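/- Let R be a TRS over a signature Σ, P a non-collapsing TRS over an extension of Σ, t_0 a term, u a non-variable term, σ and σ' substitutions, and suppose there is a finite minimal (P,R)-chain t_0 (→_{>ε,R}* · →_{ε,P})^n uσ such that (i) xσ →_R* xσ' and xσ' is a normal form of R for every variable x ∈ Var(u), and (ii) every proper subterm of uσ' is a normal form of R. If R ∪ P is a right-linear overlay system, then there exist a substitution σ'' and an innermost minimal (P,R)-chain t_0 (i→_{>ε,R}* · i→_{ε,P})^n · i→_{>ε,R}* uσ''. -/

import Mathlib

namespace RWS

/-- First-order terms over a signature `F` (function symbols of arbitrary arity,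
realized by lists of arguments) and variables `V`. -/
inductive Term (F V : Type) : Type
  | var : V → Term F V
  | app : F → List (Term F V) → Term F V

namespace Term

variable {F V : Type}

/-- `t` is a variable. -/
def IsVar : Term F V → Prop
  | var _ => True
  | app _ _ => False

/-- Application of a substitution (a map from variables to terms) to a term. -/
def subst (σ : V → Term F V) : Term F V → Term F V
  | var x => σ x
  | app f ts => app f (ts.attach.map fun t => t.1.subst σ)
decreasing_by
  simp_wf
  have := List.sizeOf_lt_of_mem t.2
  omega

/-- The list of variable occurrences of a term. -/
def varOccs : Term F V → List V
  | var x => [x]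
  | app _ ts => (ts.attach.map fun t => t.1.varOccs).flatten
decreasing_by
  simp_wf
  have := List.sizeOf_lt_of_mem t.2
  omega

/-- A term is linear if no variable occurs in it more than once. -/
def Linear (t : Term F V) : Prop := t.varOccs.Nodup

end Term

variable {F V : Type}

/-- `PSub t u` : `t` is a proper subterm of `u` (i.e. `u ▷ t`). -/
inductive PSub : Term F V → Term F V → Prop
  | head {t f ts} : t ∈ ts → PSub t (.app f ts)
  | tail {t u f ts} : PSub t u → u ∈ ts → PSub t (.app f ts)

/-- Subterm-or-equal relation. -/
def Sub (t u : Term F V) : Prop := t = u ∨ PSub t u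

/-- The rewrite relation of a set `R` of rewrite rules: contraction of a redex
at some position (root rule instance, closed under contexts). -/
inductive Rew (R : Set (Term F V × Term F V)) : Term F V → Term F V → Prop
  | root {l r : Term F V} {σ : V → Term F V} :
      (l, r) ∈ R → Rew R (l.subst σ) (r.subst σ)
  | congr {s t : Term F V} {f : F} {ts us : List (Term F V)} :
      Rew R s t → Rew R (.app f (ts ++ s :: us)) (.app f (ts ++ t :: us))

/-- `t` is a normal form of `R`. -/
def NormalForm (R : Set (Term F V × Term F V)) (t : Term F V) : Prop :=
  ∀ u, ¬ Rew R t u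

/-- Innermost rewriting: contraction of a redex all of whose proper subterms
are normal forms of `R`. -/
inductive IRew (R : Set (Term F V × Term F V)) : Term F V → Term F V → Prop
  | root {l r : Term F V} {σ : V → Term F V} :
      (l, r) ∈ R → (∀ u, PSub u (l.subst σ) → NormalForm R u) →
      IRew R (l.subst σ) (r.subst σ)
  | congr {s t : Term F V} {f : F} {ts us : List (Term F V)} :
      IRew R s t → IRew R (.app f (ts ++ s :: us)) (.app f (ts ++ t :: us))

/-- A rewrite step at the root position (`→_{ε}`). -/
def RootStep (R : Set (Term F V × Term F V)) (s t : Term F V) : Prop :=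
  ∃ l r σ, (l, r) ∈ R ∧ s = Term.subst σ l ∧ t = Term.subst σ r

/-- A rewrite step strictly below the root (`→_{>ε}`). -/
def BelowRew (R : Set (Term F V × Term F V)) (s t : Term F V) : Prop :=
  ∃ (f : F) (ts us : List (Term F V)) (a b : Term F V),
    Rew R a b ∧ s = .app f (ts ++ a :: us) ∧ t = .app f (ts ++ b :: us)

/-- An innermost rewrite step strictly below the root (`i→_{>ε}`). -/
def IBelowRew (R : Set (Term F V × Term F V)) (s t : Term F V) : Prop :=
  ∃ (f : F) (ts us : List (Term F V)) (a b : Term F V),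
    IRew R a b ∧ s = .app f (ts ++ a :: us) ∧ t = .app f (ts ++ b :: us)

/-- `R` is a term rewrite system: left-hand sides are not variables and
variables of right-hand sides occur in the corresponding left-hand sides. -/
def IsTRS (R : Set (Term F V × Term F V)) : Prop :=
  ∀ p ∈ R, ¬ p.1.IsVar ∧ ∀ x ∈ p.2.varOccs, x ∈ p.1.varOccs

/-- All right-hand sides are linear. -/
def RightLinear (R : Set (Term F V × Term F V)) : Prop :=
  ∀ p ∈ R, p.2.Linear

/-- No right-hand side is a variable. -/
def NonCollapsing (R : Set (Term F V × Term F V)) : Prop :=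
  ∀ p ∈ R, ¬ p.2.IsVar

/-- `R` has an inner-overlap: a proper non-variable subterm of some left-hand
side is unifiable (after renaming the rules apart, equivalently: some instance
of the one equals some instance of the other) with some left-hand side. -/
def InnerOverlap (R : Set (Term F V × Term F V)) : Prop :=
  ∃ l r l' r' u, (l, r) ∈ R ∧ (l', r') ∈ R ∧ PSub u l ∧ ¬ u.IsVar ∧
    ∃ σ τ : V → Term F V, u.subst σ = l'.subst τ

/-- `R` is an overlay system. -/
def Overlay (R : Set (Term F V × Term F V)) : Prop := ¬ InnerOverlap R

/-- The term `t` is terminating w.r.t. `R`: no infinite rewrite sequence starts from `t`. -/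
def Terminating (R : Set (Term F V × Term F V)) (t : Term F V) : Prop :=
  ¬ ∃ f : ℕ → Term F V, f 0 = t ∧ ∀ n, Rew R (f n) (f (n + 1))

/-- The TRS `R` is terminating: there is no infinite rewrite sequence. -/
def TerminatingTRS (R : Set (Term F V × Term F V)) : Prop :=
  ¬ ∃ f : ℕ → Term F V, ∀ n, Rew R (f n) (f (n + 1))

/-- The TRS `R` is innermost terminating: there is no infinite innermost rewrite sequence. -/
def InnermostTerminatingTRS (R : Set (Term F V × Term F V)) : Prop :=
  ¬ ∃ f : ℕ → Term F V, ∀ n, IRew R (f n) (f (n + 1))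

/-- Domain of a substitution. -/
def Dom (σ : V → Term F V) : Set V := {x | σ x ≠ .var x}

end RWS

namespace RWS

variable {F V : Type}

/-- Embedding of terms over the signature `F` into terms over the extended
signature `F ⊕ F`, where `Sum.inl f` is the original symbol `f` and
`Sum.inr f` is the fresh tuple symbol `f#`. -/
def Term.lift : Term F V → Term (F ⊕ F) V
  | .var x => .var x
  | .app f ts => .app (Sum.inl f) (ts.attach.map fun t => t.1.lift)
decreasing_by
  simp_wf
  have := List.sizeOf_lt_of_mem t.2
  omega

/-- The TRS `R` viewed over the extended signature `F ⊕ F`. -/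
def liftTRS (R : Set (Term F V × Term F V)) :
    Set (Term (F ⊕ F) V × Term (F ⊕ F) V) :=
  { p | ∃ l r, (l, r) ∈ R ∧ p = (l.lift, r.lift) }

/-- The defined symbols of `R`: root symbols of left-hand sides. -/
def DefinedSym (R : Set (Term F V × Term F V)) : Set F :=
  { f | ∃ ts r, (Term.app f ts, r) ∈ R }

/-- `t#`: the term `f(t₁,…,tₙ)` with its root replaced by the tuple symbol `f#`. -/
def Term.sharp : Term F V → Term (F ⊕ F) V
  | .var x => .var x
  | .app f ts => .app (Sum.inr f) (ts.attach.map fun t => t.1.lift)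

/-- The set of dependency pairs of `R`: rules `ℓ# → t#` where `ℓ → r ∈ R` and
`t` is a subterm of `r` whose root symbol is defined. -/
def DP (R : Set (Term F V × Term F V)) :
    Set (Term (F ⊕ F) V × Term (F ⊕ F) V) :=
  { p | ∃ l r t, (l, r) ∈ R ∧ Sub t r ∧
        (∃ g ts, t = Term.app g ts ∧ g ∈ DefinedSym R) ∧
        p = (l.sharp, t.sharp) }

/-- There is an infinite minimal `(P,R)`-chain
`t₀ →_{>ε,R}* s₀ →_{ε,P} t₁ →_{>ε,R}* s₁ →_{ε,P} t₂ ⋯` (all proper subterms of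
the `tᵢ` are terminating w.r.t. `R`). -/
def InfMinChain (P R : Set (Term F V × Term F V)) : Prop :=
  ∃ t s : ℕ → Term F V,
    (∀ i, Relation.ReflTransGen (BelowRew R) (t i) (s i)) ∧
    (∀ i, RootStep P (s i) (t (i + 1))) ∧
    (∀ i v, PSub v (t i) → Terminating R v)

/-- There is an infinite innermost minimal `(P,R)`-chain: as above, where the
below-root `R`-steps are innermost and each root `P`-step is applied to a term
all of whose proper subterms are normal forms of `R`. -/
def InfInnMinChain (P R : Set (Term F V × Term F V)) : Prop :=
  ∃ t s : ℕ → Term F V,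
    (∀ i, Relation.ReflTransGen (IBelowRew R) (t i) (s i)) ∧
    (∀ i v, PSub v (s i) → NormalForm R v) ∧
    (∀ i, RootStep P (s i) (t (i + 1))) ∧
    (∀ i v, PSub v (t i) → Terminating R v)

/-- Finite minimal `(P,R)`-chains of length `n` (number of root `P`-steps),
from the first term to the term reached right after the `n`-th root `P`-step. -/
inductive MinChainN (P R : Set (Term F V × Term F V)) :
    ℕ → Term F V → Term F V → Prop
  | refl {t : Term F V} :
      (∀ v, PSub v t → Terminating R v) → MinChainN P R 0 t t
  | step {n : ℕ} {t₀ t s t' : Term F V} :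
      MinChainN P R n t₀ t →
      Relation.ReflTransGen (BelowRew R) t s →
      RootStep P s t' →
      (∀ v, PSub v t' → Terminating R v) →
      MinChainN P R (n + 1) t₀ t'

/-- Finite innermost minimal `(P,R)`-chains of length `n`. -/
inductive InnMinChainN (P R : Set (Term F V × Term F V)) :
    ℕ → Term F V → Term F V → Prop
  | refl {t : Term F V} :
      (∀ v, PSub v t → Terminating R v) → InnMinChainN P R 0 t t
  | step {n : ℕ} {t₀ t s t' : Term F V} :
      InnMinChainN P R n t₀ t →
      Relation.ReflTransGen (IBelowRew R) t s →
      (∀ v, PSub v s → NormalForm R v) →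
      RootStep P s t' →
      (∀ v, PSub v t' → Terminating R v) →
      InnMinChainN P R (n + 1) t₀ t'

end RWS

namespace RWS

section InnermostReductions

variable {F V : Type} {R P Q : Set (Term F V × Term F V)}

open Relation

/-- Structural induction on terms, with the hypothesis available for all arguments. -/
theorem Term.inductionArgs {motive : Term F V → Prop} (var : ∀ x, motive (.var x))
    (app : ∀ f ts, (∀ t ∈ ts, motive t) → motive (.app f ts)) : ∀ t, motive t
  | .var x => var x
  | .app f ts => app f ts fun t _ => Term.inductionArgs var app t
decreasing_by
  have := List.sizeOf_lt_of_mem ‹t ∈ ts›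
  simp_wf
  omega

theorem Term.subst_app (σ : V → Term F V) (f : F) (ts : List (Term F V)) :
    (Term.app f ts).subst σ = .app f (ts.map (Term.subst σ)) := by
  rw [Term.subst]
  simp

theorem Term.varOccs_app (f : F) (ts : List (Term F V)) :
    (Term.app f ts).varOccs = (ts.map Term.varOccs).flatten := by
  rw [Term.varOccs]
  simp

theorem Term.mem_varOccs_app {f : F} {ts : List (Term F V)} {t : Term F V} {x : V}
    (ht : t ∈ ts) (hx : x ∈ t.varOccs) : x ∈ (Term.app f ts).varOccs := by
  rw [Term.varOccs_app, List.mem_flatten]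
  exact ⟨_, List.mem_map_of_mem ht, hx⟩

theorem Term.subst_congr {σ τ : V → Term F V} (t : Term F V) :
    (∀ x ∈ t.varOccs, σ x = τ x) → t.subst σ = t.subst τ := by
  induction t using Term.inductionArgs with
  | var x => intro h; simpa [Term.subst] using h x (by simp [Term.varOccs])
  | app f ts ih =>
    intro h
    rw [Term.subst_app, Term.subst_app, List.map_congr_left]
    exact fun t ht => ih t ht fun x hx => h x (mem_varOccs_app ht hx)

theorem Term.eq_app_of_not_isVar {t : Term F V} (h : ¬ t.IsVar) : ∃ f ts, t = .app f ts := by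
  cases t with
  | var x => exact absurd trivial h
  | app f ts => exact ⟨f, ts, rfl⟩

/-- Every proper subterm is a subterm of an argument. -/
theorem psub_app_iff {t : Term F V} {f : F} {ts : List (Term F V)} :
    PSub t (.app f ts) ↔ ∃ a ∈ ts, Sub t a := by
  constructor
  · intro h
    cases h with
    | head h => exact ⟨t, h, .inl rfl⟩
    | tail h h' => exact ⟨_, h', .inr h⟩
  · rintro ⟨a, ha, rfl | h⟩
    · exact .head ha
    · exact .tail h ha

theorem PSub.trans {s t u : Term F V} (h : PSub s t) (h' : PSub t u) : PSub s u := by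
  induction h' with
  | head hm => exact .tail h hm
  | tail _ hm ih => exact .tail ih hm

/-- A step in a proper subterm extends to a step in the surrounding term. -/
theorem PSub.rew {s t : Term F V} (h : PSub s t) :
    ∀ {s'}, Rew R s s' → ∃ t', Rew R t t' ∧ PSub s' t' := by
  induction h with
  | head hm =>
    intro s' hs
    obtain ⟨as, bs, rfl⟩ := List.append_of_mem hm
    exact ⟨_, .congr hs, .head (by simp)⟩
  | tail _ hm ih =>
    intro s' hs
    obtain ⟨t', ht', hp⟩ := ih hs
    obtain ⟨as, bs, rfl⟩ := List.append_of_mem hm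
    exact ⟨_, .congr ht', .tail hp (by simp)⟩

theorem PSub.rew_trans {s t s' : Term F V} (h : PSub s t) (hs : ReflTransGen (Rew R) s s') :
    ∃ t', ReflTransGen (Rew R) t t' ∧ PSub s' t' := by
  induction hs with
  | refl => exact ⟨t, .refl, h⟩
  | tail _ hs ih =>
    obtain ⟨t', ht', hp⟩ := ih
    obtain ⟨t'', ht'', hp'⟩ := hp.rew hs
    exact ⟨t'', ht'.tail ht'', hp'⟩

theorem NormalForm.psub {s t : Term F V} (h : NormalForm R t) (hs : PSub s t) :
    NormalForm R s := fun _ hu =>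
  let ⟨_, ht', _⟩ := hs.rew hu
  h _ ht'

theorem NormalForm.sub {s t : Term F V} (h : NormalForm R t) (hs : Sub s t) :
    NormalForm R s := by
  rcases hs with rfl | hs
  exacts [h, h.psub hs]

theorem terminating_iff_acc {t : Term F V} :
    Terminating R t ↔ Acc (fun a b => Rew R b a) t := by
  rw [← not_iff_not, not_acc_iff_exists_descending_chain, Terminating, not_not]

theorem Terminating.rew {s t : Term F V} (h : Terminating R s) (hs : ReflTransGen (Rew R) s t) :
    Terminating R t := by
  rw [terminating_iff_acc] at *
  induction hs with
  | refl => exact h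
  | tail _ hs ih => exact ih.inv hs

theorem Terminating.psub {s t : Term F V} (h : Terminating R t) (hs : PSub s t) :
    Terminating R s := by
  rw [terminating_iff_acc] at *
  induction h generalizing s with
  | intro t _ ih =>
    refine ⟨_, fun s' hs' => ?_⟩
    obtain ⟨t', ht', hp⟩ := hs.rew hs'
    exact ih t' ht' hp

theorem Terminating.exists_normalForm {t : Term F V} (h : Terminating R t) :
    ∃ q, ReflTransGen (Rew R) t q ∧ NormalForm R q := by
  rw [terminating_iff_acc] at h
  induction h with
  | intro t _ ih =>
    by_cases hn : NormalForm R t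
    · exact ⟨t, .refl, hn⟩
    · simp only [NormalForm, not_forall, not_not] at hn
      obtain ⟨t', ht'⟩ := hn
      obtain ⟨q, hq, hqn⟩ := ih t' ht'
      exact ⟨q, hq.head ht', hqn⟩

theorem IRew.rew {s t : Term F V} (h : IRew R s t) : Rew R s t := by
  induction h with
  | root h _ => exact .root h
  | congr _ ih => exact .congr ih

theorem BelowRew.rew {s t : Term F V} (h : BelowRew R s t) : Rew R s t := by
  obtain ⟨f, ts, us, a, b, h, rfl, rfl⟩ := h
  exact .congr h

theorem IBelowRew.iRew {s t : Term F V} (h : IBelowRew R s t) : IRew R s t := by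
  obtain ⟨f, ts, us, a, b, h, rfl, rfl⟩ := h
  exact .congr h

theorem Rew.below_or_root {s t : Term F V} (h : Rew R s t) : BelowRew R s t ∨ RootStep R s t := by
  cases h with
  | root h => exact .inr ⟨_, _, _, h, rfl, rfl⟩
  | congr h => exact .inl ⟨_, _, _, _, _, h, rfl, rfl⟩

theorem IRew.below_or_normal {s t : Term F V} (h : IRew R s t) :
    IBelowRew R s t ∨ ∀ u, PSub u s → NormalForm R u := by
  cases h with
  | root _ h => exact .inr h
  | congr h => exact .inl ⟨_, _, _, _, _, h, rfl, rfl⟩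

/-- A reduction is below the root, up to its first root step if there is one. -/
theorem below_or_first_root {s q : Term F V} (h : ReflTransGen (Rew R) s q) :
    ReflTransGen (BelowRew R) s q ∨ ∃ a b, ReflTransGen (BelowRew R) s a ∧ RootStep R a b ∧
      ReflTransGen (Rew R) b q := by
  induction h using ReflTransGen.head_induction_on with
  | refl => exact .inl .refl
  | head hs hq ih =>
    rcases hs.below_or_root with hb | hr
    · rcases ih with ih | ⟨a, b, h1, h2, h3⟩
      · exact .inl (ih.head hb)
      · exact .inr ⟨a, b, h1.head hb, h2, h3⟩
    · exact .inr ⟨_, _, .refl, hr, hq⟩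

/-- An innermost reduction to a normal form first normalizes all arguments. -/
theorem exists_iBelow_normal_args {s q : Term F V} (h : ReflTransGen (IRew R) s q)
    (hq : NormalForm R q) :
    ∃ a, ReflTransGen (IBelowRew R) s a ∧ (∀ u, PSub u a → NormalForm R u) ∧
      ReflTransGen (IRew R) a q := by
  induction h using ReflTransGen.head_induction_on with
  | refl => exact ⟨q, .refl, fun _ hu => hq.psub hu, .refl⟩
  | head hs hs' ih =>
    rcases hs.below_or_normal with hb | hr
    · obtain ⟨a, h1, h2, h3⟩ := ih
      exact ⟨a, h1.head hb, h2, h3⟩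
    · exact ⟨_, .refl, hr, hs'.head hs⟩

theorem forall₂_reflTransGen_refl {α : Type} {r : α → α → Prop} (as : List α) :
    List.Forall₂ (ReflTransGen r) as as := by
  induction as with
  | nil => exact .nil
  | cons a as ih => exact .cons .refl ih

theorem forall₂_reflTransGen_step {α : Type} {r : α → α → Prop} {cs as bs : List α} {a b : α}
    (h : List.Forall₂ (ReflTransGen r) cs (as ++ a :: bs)) (hab : r a b) :
    List.Forall₂ (ReflTransGen r) cs (as ++ b :: bs) := by
  induction as generalizing cs with
  | nil =>
    cases h with
    | cons h hs => exact .cons (h.tail hab) hs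
  | cons d as ih =>
    cases h with
    | cons h hs => exact .cons h (ih hs)

/-- Closure of a relation on terms under contexts of depth one. -/
def InArg (r : Term F V → Term F V → Prop) (s t : Term F V) : Prop :=
  ∃ (f : F) (ts us : List (Term F V)) (a b : Term F V),
    r a b ∧ s = .app f (ts ++ a :: us) ∧ t = .app f (ts ++ b :: us)

theorem forall₂_of_inArg {r : Term F V → Term F V → Prop} {f : F} {ts : List (Term F V)}
    {s : Term F V} (h : ReflTransGen (InArg r) (.app f ts) s) :
    ∃ ss, s = .app f ss ∧ List.Forall₂ (ReflTransGen r) ts ss := by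
  induction h with
  | refl => exact ⟨ts, rfl, forall₂_reflTransGen_refl ts⟩
  | tail _ hs ih =>
    obtain ⟨ss, rfl, h⟩ := ih
    obtain ⟨g, as, bs, a, b, hab, heq, rfl⟩ := hs
    cases heq
    exact ⟨_, rfl, forall₂_reflTransGen_step h hab⟩

theorem inArg_of_forall₂ {r : Term F V → Term F V → Prop} {f : F} {ts ss : List (Term F V)}
    (h : List.Forall₂ (ReflTransGen r) ts ss) :
    ReflTransGen (InArg r) (.app f ts) (.app f ss) := by
  suffices H : ∀ as, ReflTransGen (InArg r) (.app f (as ++ ts)) (.app f (as ++ ss)) from H []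
  induction h with
  | nil => exact fun _ => .refl
  | @cons t s ts ss h _ ih =>
    intro as
    have h1 : ReflTransGen (InArg r) (.app f (as ++ t :: ts)) (.app f (as ++ s :: ts)) :=
      h.lift (fun a => Term.app f (as ++ a :: ts)) fun a b hab => ⟨f, as, ts, a, b, hab, rfl, rfl⟩
    have h2 := ih (as ++ [s])
    simp only [List.append_assoc, List.singleton_append] at h2
    exact h1.trans h2

theorem forall₂_of_belowRew {f : F} {ts : List (Term F V)} {s : Term F V}
    (h : ReflTransGen (BelowRew R) (.app f ts) s) :
    ∃ ss, s = .app f ss ∧ List.Forall₂ (ReflTransGen (Rew R)) ts ss :=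
  forall₂_of_inArg h

theorem belowRew_of_forall₂ {f : F} {ts ss : List (Term F V)}
    (h : List.Forall₂ (ReflTransGen (Rew R)) ts ss) :
    ReflTransGen (BelowRew R) (.app f ts) (.app f ss) :=
  inArg_of_forall₂ h

theorem forall₂_of_iBelowRew {f : F} {ts : List (Term F V)} {s : Term F V}
    (h : ReflTransGen (IBelowRew R) (.app f ts) s) :
    ∃ ss, s = .app f ss ∧ List.Forall₂ (ReflTransGen (IRew R)) ts ss :=
  forall₂_of_inArg h

theorem iBelowRew_of_forall₂ {f : F} {ts ss : List (Term F V)}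
    (h : List.Forall₂ (ReflTransGen (IRew R)) ts ss) :
    ReflTransGen (IBelowRew R) (.app f ts) (.app f ss) :=
  inArg_of_forall₂ h

theorem rew_of_belowRew {s t : Term F V} (h : ReflTransGen (BelowRew R) s t) :
    ReflTransGen (Rew R) s t :=
  h.lift id fun _ _ => BelowRew.rew

theorem rew_of_iRew {s t : Term F V} (h : ReflTransGen (IRew R) s t) :
    ReflTransGen (Rew R) s t :=
  h.lift id fun _ _ => IRew.rew

theorem iRew_of_iBelowRew {s t : Term F V} (h : ReflTransGen (IBelowRew R) s t) :
    ReflTransGen (IRew R) s t :=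
  h.lift id fun _ _ => IBelowRew.iRew

theorem Term.rew_subst {σ τ : V → Term F V} (t : Term F V) :
    (∀ x ∈ t.varOccs, ReflTransGen (Rew R) (σ x) (τ x)) →
    ReflTransGen (Rew R) (t.subst σ) (t.subst τ) := by
  induction t using Term.inductionArgs with
  | var x => intro h; simpa [Term.subst] using h x (by simp [Term.varOccs])
  | app f ts ih =>
    intro h
    rw [Term.subst_app, Term.subst_app]
    refine rew_of_belowRew (belowRew_of_forall₂ ?_)
    rw [List.forall₂_map_left_iff, List.forall₂_map_right_iff, List.forall₂_same]
    exact fun t ht => ih t ht fun x hx => h x (mem_varOccs_app ht hx)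

theorem Term.belowRew_subst {σ τ : V → Term F V} {t : Term F V} (ht : ¬ t.IsVar)
    (h : ∀ x ∈ t.varOccs, ReflTransGen (Rew R) (σ x) (τ x)) :
    ReflTransGen (BelowRew R) (t.subst σ) (t.subst τ) := by
  obtain ⟨f, ts, rfl⟩ := eq_app_of_not_isVar ht
  rw [Term.subst_app, Term.subst_app]
  refine belowRew_of_forall₂ ?_
  rw [List.forall₂_map_left_iff, List.forall₂_map_right_iff, List.forall₂_same]
  exact fun t ht => t.rew_subst fun x hx => h x (mem_varOccs_app ht hx)

theorem Term.sub_subst {σ : V → Term F V} {x : V} (t : Term F V) :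
    x ∈ t.varOccs → Sub (σ x) (t.subst σ) := by
  induction t using Term.inductionArgs with
  | var y =>
    intro h
    simp only [Term.varOccs, List.mem_singleton] at h
    subst h
    exact .inl (by rw [Term.subst])
  | app f ts ih =>
    intro h
    rw [Term.varOccs_app, List.mem_flatten] at h
    obtain ⟨_, h1, hx⟩ := h
    obtain ⟨t, ht, rfl⟩ := List.mem_map.1 h1
    rw [Term.subst_app]
    exact .inr (psub_app_iff.2 ⟨_, List.mem_map_of_mem ht, ih t ht hx⟩)

theorem Term.psub_subst {σ : V → Term F V} {x : V} {t : Term F V} (ht : ¬ t.IsVar)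
    (hx : x ∈ t.varOccs) : PSub (σ x) (t.subst σ) := by
  obtain ⟨f, ts, rfl⟩ := eq_app_of_not_isVar ht
  rw [Term.varOccs_app, List.mem_flatten] at hx
  obtain ⟨_, h1, hx⟩ := hx
  obtain ⟨t, ht, rfl⟩ := List.mem_map.1 h1
  rw [Term.subst_app]
  exact psub_app_iff.2 ⟨_, List.mem_map_of_mem ht, t.sub_subst hx⟩

/-- In an overlay system, a left-hand side instantiated with normal forms has only normal
proper subterms. -/
theorem Overlay.normal_psub_subst (hOV : Overlay Q) (hRQ : R ⊆ Q) {l r : Term F V}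
    (hl : (l, r) ∈ Q) (hv : ¬ l.IsVar) {σ : V → Term F V}
    (hσ : ∀ x ∈ l.varOccs, NormalForm R (σ x)) :
    ∀ v, PSub v (l.subst σ) → NormalForm R v := by
  have key : ∀ w, PSub w l → (∀ x ∈ w.varOccs, NormalForm R (σ x)) →
      NormalForm R (w.subst σ) := by
    intro w
    induction w using Term.inductionArgs with
    | var x => intro _ h; simpa [Term.subst] using h x (by simp [Term.varOccs])
    | app f ts ih =>
      intro hp hx u hu
      rcases hu.below_or_root with hb | ⟨l', r', τ, hl', heq, -⟩
      · obtain ⟨g, as, bs, a, b, hab, heq, -⟩ := hb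
        rw [Term.subst_app] at heq
        injection heq with _ hts
        have ha : a ∈ ts.map (Term.subst σ) := by rw [hts]; simp
        obtain ⟨t, ht, rfl⟩ := List.mem_map.1 ha
        exact ih t ht (PSub.trans (.head ht) hp)
          (fun x hx' => hx x (Term.mem_varOccs_app ht hx')) _ hab
      · exact hOV ⟨l, r, l', r', _, hl, hRQ hl', hp, id, σ, τ, heq⟩
  obtain ⟨f, ts, rfl⟩ := Term.eq_app_of_not_isVar hv
  intro v hpv
  rw [Term.subst_app, psub_app_iff] at hpv
  obtain ⟨_, h1, hsub⟩ := hpv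
  obtain ⟨t, ht, rfl⟩ := List.mem_map.1 h1
  exact (key t (.head ht) fun x hx => hσ x (Term.mem_varOccs_app ht hx)).sub hsub

/-- Normalizing the substitution first, for a jointly linear list of terms, given that this is
possible for each of the terms. -/
theorem exists_normal_subst_list {θ : V → Term F V} {ts qs : List (Term F V)}
    (hlin : (ts.map Term.varOccs).flatten.Nodup)
    (hstep : ∀ t ∈ ts, t.varOccs.Nodup → ∀ q, ReflTransGen (IRew R) (t.subst θ) q →
      NormalForm R q → ∃ θ' : V → Term F V,
        (∀ x ∈ t.varOccs, ReflTransGen (IRew R) (θ x) (θ' x) ∧ NormalForm R (θ' x)) ∧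
        ReflTransGen (IRew R) (t.subst θ') q)
    (hred : List.Forall₂ (ReflTransGen (IRew R)) (ts.map (Term.subst θ)) qs)
    (hq : ∀ q ∈ qs, NormalForm R q) :
    ∃ θ' : V → Term F V,
      (∀ x ∈ (ts.map Term.varOccs).flatten,
        ReflTransGen (IRew R) (θ x) (θ' x) ∧ NormalForm R (θ' x)) ∧
      List.Forall₂ (ReflTransGen (IRew R)) (ts.map (Term.subst θ')) qs := by
  classical
  induction ts generalizing qs with
  | nil => exact ⟨θ, by simp, hred⟩
  | cons t ts ih =>
    rw [List.map_cons] at hred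
    cases hred with
    | @cons _ q _ qs h hs =>
      rw [List.map_cons, List.flatten_cons, List.nodup_append'] at hlin
      obtain ⟨hl1, hl2, hdisj⟩ := hlin
      obtain ⟨θ₁, hθ₁, h₁⟩ := hstep t (by simp) hl1 q h (hq q (by simp))
      obtain ⟨θ₂, hθ₂, h₂⟩ := ih hl2 (fun t ht => hstep t (by simp [ht])) hs
        (fun q hq' => hq q (by simp [hq']))
      refine ⟨fun x => if x ∈ t.varOccs then θ₁ x else θ₂ x, ?_, ?_⟩
      · intro x hx
        rw [List.map_cons, List.flatten_cons, List.mem_append] at hx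
        by_cases hxt : x ∈ t.varOccs
        · simpa [hxt] using hθ₁ x hxt
        · simpa [hxt] using hθ₂ x (hx.resolve_left hxt)
      · rw [List.map_cons]
        refine .cons ?_ ?_
        · rwa [Term.subst_congr (τ := θ₁) t (fun x hx => by simp [hx])]
        · rw [List.map_congr_left (g := Term.subst θ₂)]
          · exact h₂
          · intro s hs
            refine Term.subst_congr s fun x hx => ?_
            have : x ∉ t.varOccs := fun hxt =>
              hdisj hxt (List.mem_flatten.2 ⟨_, List.mem_map_of_mem hs, hx⟩)
            simp [this]

/-- An innermost normalization of an instance of a linear term can start by normalizing the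
substitution. -/
theorem exists_normal_subst (r : Term F V) {θ : V → Term F V} : r.varOccs.Nodup →
    ∀ q, ReflTransGen (IRew R) (r.subst θ) q → NormalForm R q → ∃ θ' : V → Term F V,
      (∀ x ∈ r.varOccs, ReflTransGen (IRew R) (θ x) (θ' x) ∧ NormalForm R (θ' x)) ∧
      ReflTransGen (IRew R) (r.subst θ') q := by
  induction r using Term.inductionArgs with
  | var x =>
    intro _ q h hq
    refine ⟨fun _ => q, fun y hy => ?_, by rw [Term.subst]⟩
    simp only [Term.varOccs, List.mem_singleton] at hy
    subst hy
    rw [Term.subst] at h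
    exact ⟨h, hq⟩
  | app f ts ih =>
    intro hlin q h hq
    obtain ⟨a, h1, hn, h2⟩ := exists_iBelow_normal_args h hq
    rw [Term.subst_app] at h1
    obtain ⟨ps, rfl, hps⟩ := forall₂_of_iBelowRew h1
    rw [Term.varOccs_app] at hlin ⊢
    obtain ⟨θ', hθ', hred⟩ := exists_normal_subst_list hlin ih hps fun p hp => hn p (.head hp)
    refine ⟨θ', hθ', ?_⟩
    rw [Term.subst_app]
    exact (iRew_of_iBelowRew (iBelowRew_of_forall₂ hred)).trans h2

/-- A normalization of a substitution on `p` extends to one on `s`, if all terms assigned to `s`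
terminate. -/
theorem exists_normal_subst_extension {p : V → Prop} {s : List V} {θ θ₁ : V → Term F V}
    (hθ₁ : ∀ x, p x → ReflTransGen (Rew R) (θ x) (θ₁ x) ∧ NormalForm R (θ₁ x))
    (hs : ∀ x ∈ s, Terminating R (θ x)) :
    ∃ θ' : V → Term F V, (∀ x, p x → θ' x = θ₁ x) ∧
      ∀ x ∈ s, ReflTransGen (Rew R) (θ x) (θ' x) ∧ NormalForm R (θ' x) := by
  classical
  have : ∀ x, ∃ q, (p x → q = θ₁ x) ∧
      (x ∈ s → ReflTransGen (Rew R) (θ x) q ∧ NormalForm R q) := by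
    intro x
    by_cases hp : p x
    · exact ⟨θ₁ x, fun _ => rfl, fun _ => hθ₁ x hp⟩
    · by_cases hx : x ∈ s
      · obtain ⟨q, hq⟩ := (hs x hx).exists_normalForm
        exact ⟨q, fun h => absurd h hp, fun _ => hq⟩
      · exact ⟨θ x, fun h => absurd h hp, fun h => absurd h hx⟩
  choose θ' h1 h2 using this
  exact ⟨θ', h1, h2⟩

theorem forall₂_iRew_of_rew {ts qs : List (Term F V)}
    (hstep : ∀ t ∈ ts, ∀ q, ReflTransGen (Rew R) t q → NormalForm R q → ReflTransGen (IRew R) t q)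
    (h : List.Forall₂ (ReflTransGen (Rew R)) ts qs) (hq : ∀ q ∈ qs, NormalForm R q) :
    List.Forall₂ (ReflTransGen (IRew R)) ts qs := by
  induction h with
  | nil => exact .nil
  | @cons t q ts qs h _ ih =>
    exact .cons (hstep t (by simp) q h (hq q (by simp)))
      (ih (fun t ht => hstep t (by simp [ht])) fun q hq' => hq q (by simp [hq']))

/-- In a right-linear overlay system, innermost reductions reach all normal forms of a
terminating term. -/
theorem Terminating.iRew_of_rew (hTRS : IsTRS R) (hRL : RightLinear R) (hOV : Overlay R)
    {t q : Term F V} (ht : Terminating R t) (h : ReflTransGen (Rew R) t q)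
    (hq : NormalForm R q) : ReflTransGen (IRew R) t q := by
  suffices H : ∀ s, Sub s t → ∀ q, ReflTransGen (Rew R) s q → NormalForm R q →
      ReflTransGen (IRew R) s q from H t (.inl rfl) q h hq
  clear h hq q
  have hacc := (terminating_iff_acc.1 ht).transGen
  induction hacc with
  | intro t _ ih =>
  intro s
  induction s using Term.inductionArgs with
  | var x =>
    intro _ q h hq
    rcases below_or_first_root h with hb | ⟨a, b, hb, ⟨l, r, τ, hl, rfl, rfl⟩, -⟩
    · rcases hb.cases_head with rfl | ⟨_, ⟨_, _, _, _, _, _, heq, _⟩, _⟩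
      · exact .refl
      · cases heq
    · obtain ⟨f, ls, rfl⟩ := Term.eq_app_of_not_isVar (hTRS _ hl).1
      rw [Term.subst_app] at hb
      rcases hb.cases_head with heq | ⟨_, ⟨_, _, _, _, _, _, heq, _⟩, _⟩ <;> cases heq
  | app f ts ihs =>
    intro hst q h hq
    have hargs : ∀ a ∈ ts, ∀ q, ReflTransGen (Rew R) a q → NormalForm R q →
        ReflTransGen (IRew R) a q := by
      refine fun a ha => ihs a ha (.inr ?_)
      rcases hst with rfl | hst
      exacts [.head ha, .trans (.head ha) hst]
    have hsterm : Terminating R (.app f ts) := by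
      rcases hst with rfl | hst
      exacts [ht, ht.psub hst]
    rcases below_or_first_root h with hb | ⟨_, _, hb, ⟨l, r, θ, hl, rfl, rfl⟩, hrq⟩
    · obtain ⟨qs, rfl, hqs⟩ := forall₂_of_belowRew hb
      exact iRew_of_iBelowRew <| iBelowRew_of_forall₂ <|
        forall₂_iRew_of_rew hargs hqs fun q hq' => hq.psub (.head hq')
    · have hlv := (hTRS _ hl).1
      have hri : ReflTransGen (IRew R) (r.subst θ) q := by
        rcases hst with rfl | hst
        · have h1 := TransGen.tail' (rew_of_belowRew hb) (Rew.root (σ := θ) hl)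
          exact ih _ (transGen_swap.1 h1) (ht.rew h1.to_reflTransGen) _ (.inl rfl) q hrq hq
        · obtain ⟨t₁, ht₁, hp₁⟩ := hst.rew_trans (rew_of_belowRew hb)
          obtain ⟨t₂, ht₂, hp₂⟩ := hp₁.rew (Rew.root hl)
          have h1 := TransGen.tail' ht₁ ht₂
          exact ih _ (transGen_swap.1 h1) (ht.rew h1.to_reflTransGen) _ (.inr hp₂) q hrq hq
      obtain ⟨θ₁, hθ₁, hr₁⟩ := exists_normal_subst r (hRL _ hl) q hri hq
      obtain ⟨θ', hθθ, hθ'⟩ := exists_normal_subst_extension (s := l.varOccs)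
        (fun x hx => ⟨rew_of_iRew (hθ₁ x hx).1, (hθ₁ x hx).2⟩)
        (fun x hx => (hsterm.rew (rew_of_belowRew hb)).psub (Term.psub_subst hlv hx))
      rw [← Term.subst_congr r hθθ] at hr₁
      have hn := hOV.normal_psub_subst subset_rfl hl hlv fun x hx => (hθ' x hx).2
      have hb' := hb.trans (Term.belowRew_subst hlv fun x hx => (hθ' x hx).1)
      obtain ⟨ls, hls, hred⟩ := forall₂_of_belowRew hb'
      have hred' := iRew_of_iBelowRew (iBelowRew_of_forall₂ (f := f) <|
        forall₂_iRew_of_rew hargs hred fun q hq' => hn q (hls ▸ .head hq'))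
      rw [← hls] at hred'
      exact hred'.trans (hr₁.head (.root hl hn))

/-- If all proper subterms terminate, reductions below the root to a term with normal arguments
can be made innermost. -/
theorem iBelowRew_of_belowRew (hTRS : IsTRS R) (hRL : RightLinear R) (hOV : Overlay R)
    {t q : Term F V} (ht : ∀ v, PSub v t → Terminating R v)
    (h : ReflTransGen (BelowRew R) t q) (hq : ∀ v, PSub v q → NormalForm R v) :
    ReflTransGen (IBelowRew R) t q := by
  cases t with
  | var x =>
    rcases h.cases_head with rfl | ⟨_, ⟨_, _, _, _, _, _, heq, _⟩, _⟩
    · exact .refl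
    · cases heq
  | app f ts =>
    obtain ⟨qs, rfl, hqs⟩ := forall₂_of_belowRew h
    exact iBelowRew_of_forall₂ <| forall₂_iRew_of_rew
      (fun a ha _ => (ht a (.head ha)).iRew_of_rew hTRS hRL hOV) hqs fun q hq' => hq q (.head hq')

theorem terminating_psub_of_belowRew {t s : Term F V} (ht : ∀ v, PSub v t → Terminating R v)
    (h : ReflTransGen (BelowRew R) t s) : ∀ v, PSub v s → Terminating R v := by
  induction h with
  | refl => exact ht
  | tail _ hs ih =>
    obtain ⟨f, as, bs, a, b, hab, rfl, rfl⟩ := hs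
    intro v hv
    obtain ⟨c, hc, hsub⟩ := psub_app_iff.1 hv
    have hcT : Terminating R c := by
      rw [List.mem_append, List.mem_cons] at hc
      rcases hc with hc | rfl | hc
      · exact ih c (.head (by simp [hc]))
      · exact (ih a (.head (by simp))).rew (.single hab)
      · exact ih c (.head (by simp [hc]))
    rcases hsub with rfl | hsub
    exacts [hcT, hcT.psub hsub]

theorem MinChainN.terminating_psub {n : ℕ} {s t : Term F V} (h : MinChainN P R n s t) :
    ∀ v, PSub v t → Terminating R v := by
  cases h <;> assumption

/-- Minimal chains followed by a reduction below the root to a term with normal arguments can be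
made innermost. -/
theorem MinChainN.exists_innermost (hR : IsTRS R) (hP : IsTRS P) (hnc : NonCollapsing P)
    (hRL : RightLinear (R ∪ P)) (hOV : Overlay (R ∪ P)) {n : ℕ} {t₀ t q : Term F V}
    (hchain : MinChainN P R n t₀ t) (h : ReflTransGen (BelowRew R) t q)
    (hq : ∀ v, PSub v q → NormalForm R v) :
    ∃ w, InnMinChainN P R n t₀ w ∧ ReflTransGen (IBelowRew R) w q := by
  have hRL' : RightLinear R := fun p hp => hRL p (.inl hp)
  have hOV' : Overlay R := fun ⟨l, r, l', r', u, h1, h2, h3⟩ =>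
    hOV ⟨l, r, l', r', u, .inl h1, .inl h2, h3⟩
  induction hchain generalizing q with
  | refl ht => exact ⟨_, .refl ht, iBelowRew_of_belowRew hR hRL' hOV' ht h hq⟩
  | step hc hb hroot ht ih =>
    have hi := iBelowRew_of_belowRew hR hRL' hOV' ht h hq
    obtain ⟨l, r, θ, hl, rfl, rfl⟩ := hroot
    have hlv := (hP _ hl).1
    have hrv := hnc _ hl
    obtain ⟨θ₁, hθ₁, hr₁⟩ : ∃ θ₁ : V → Term F V,
        (∀ x ∈ r.varOccs, ReflTransGen (IRew R) (θ x) (θ₁ x) ∧ NormalForm R (θ₁ x)) ∧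
        ReflTransGen (IBelowRew R) (r.subst θ₁) q := by
      have hlin : r.varOccs.Nodup := hRL _ (.inr hl)
      obtain ⟨f, rs, rfl⟩ := Term.eq_app_of_not_isVar hrv
      rw [Term.subst_app] at hi
      obtain ⟨qs, rfl, hqs⟩ := forall₂_of_iBelowRew hi
      rw [Term.varOccs_app] at hlin ⊢
      obtain ⟨θ₁, hθ₁, hred⟩ := exists_normal_subst_list hlin
        (fun t _ => exists_normal_subst t) hqs fun q hq' => hq q (.head hq')
      exact ⟨θ₁, hθ₁, by rw [Term.subst_app]; exact iBelowRew_of_forall₂ hred⟩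
    have hlT := terminating_psub_of_belowRew hc.terminating_psub hb
    obtain ⟨θ', hθθ, hθ'⟩ := exists_normal_subst_extension (s := l.varOccs)
      (fun x hx => ⟨rew_of_iRew (hθ₁ x hx).1, (hθ₁ x hx).2⟩)
      (fun x hx => hlT _ (Term.psub_subst hlv hx))
    rw [← Term.subst_congr r hθθ] at hr₁
    have hn := hOV.normal_psub_subst Set.subset_union_left (.inr hl) hlv fun x hx => (hθ' x hx).2
    obtain ⟨w, hw, hwl⟩ := ih (hb.trans (Term.belowRew_subst hlv fun x hx => (hθ' x hx).1)) hn
    refine ⟨r.subst θ', .step hw hwl hn ⟨l, r, θ', hl, rfl, rfl⟩ ?_, hr₁⟩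
    exact terminating_psub_of_belowRew ht
      (Term.belowRew_subst hrv fun x hx => (hθ' x ((hP _ hl).2 x hx)).1)

end InnermostReductions

/-- Given a finite minimal `(P,R)`-chain
`t₀ (→_{>ε,R}* · →_{ε,P})ⁿ uσ` with `u` non-variable, `xσ →_R* xσ' ∈ NF_R` for
all `x ∈ Var u`, and all proper subterms of `uσ'` normal forms of `R`:
if `R ∪ P` is a right-linear overlay system, then there exist a substitution
`σ''` and an innermost minimal `(P,R)`-chain
`t₀ (i→_{>ε,R}* · i→_{ε,P})ⁿ · i→_{>ε,R}* uσ''`. -/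
theorem exists_innermost_minimal_chain_same_length
    {F V : Type} {R P : Set (Term F V × Term F V)}
    (hR : IsTRS R) (hP : IsTRS P) (hnc : NonCollapsing P)
    (hRL : RightLinear (R ∪ P)) (hOV : Overlay (R ∪ P))
    (n : ℕ) (t₀ u : Term F V) (σ σ' : V → Term F V)
    (hu : ¬ u.IsVar)
    (hchain : MinChainN P R n t₀ (u.subst σ))
    (hσ : ∀ x ∈ u.varOccs,
      Relation.ReflTransGen (Rew R) (σ x) (σ' x) ∧ NormalForm R (σ' x))
    (hsub : ∀ v, PSub v (u.subst σ') → NormalForm R v) :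
    ∃ (σ'' : V → Term F V) (w : Term F V),
      InnMinChainN P R n t₀ w ∧
      Relation.ReflTransGen (IBelowRew R) w (u.subst σ'') := by
  obtain ⟨w, hw, hred⟩ := hchain.exists_innermost hR hP hnc hRL hOV
    (Term.belowRew_subst hu fun x hx => (hσ x hx).1) hsub
  exact ⟨σ', w, hw, hred⟩

end RWS
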